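/- Let (A,(·,·,·)) be a partially associative 3-algebra over a field k and let P: A → A be a Rota-Baxter operator of weight zero on it. Define three trilinear operations on A by ↖(x,y,z) := (x,P(y),P(z)), ↑(x,y,z) := (P(x),y,P(z)), ↗(x,y,z) := (P(x),P(y),z). Then (A,↖,↑,↗) is a partially dendriform 3-algebra. -/

import Mathlib

/-- The sum of three ternary operations. -/
def star3 {A : Type*} [AddCommGroup A] (f g h : A → A → A → A) : A → A → A → A :=
  fun x y z => f x y z + g x y z + h x y z

/-- A partially associative 3-algebra structure on a ternary operation. -/
def PartAssoc3 {A : Type*} [AddCommGroup A] (m : A → A → A → A) : Prop :=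
  ∀ x1 x2 x3 x4 x5 : A,
    m (m x1 x2 x3) x4 x5 + m x1 (m x2 x3 x4) x5 + m x1 x2 (m x3 x4 x5) = 0

/-- The defining relations of a partially dendriform 3-algebra with operations
`↖ = nw`, `↑ = up`, `↗ = ne`. -/
def PartDend3 {A : Type*} [AddCommGroup A] (nw up ne : A → A → A → A) : Prop :=
  (∀ x1 x2 x3 x4 x5 : A,
    nw (nw x1 x2 x3) x4 x5 + nw x1 (star3 nw up ne x2 x3 x4) x5
      + nw x1 x2 (star3 nw up ne x3 x4 x5) = 0) ∧
  (∀ x1 x2 x3 x4 x5 : A,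
    nw (up x1 x2 x3) x4 x5 + up x1 (nw x2 x3 x4) x5
      + up x1 x2 (star3 nw up ne x3 x4 x5) = 0) ∧
  (∀ x1 x2 x3 x4 x5 : A,
    nw (ne x1 x2 x3) x4 x5 + up x1 (up x2 x3 x4) x5
      + ne x1 x2 (nw x3 x4 x5) = 0) ∧
  (∀ x1 x2 x3 x4 x5 : A,
    up (star3 nw up ne x1 x2 x3) x4 x5 + up x1 (ne x2 x3 x4) x5
      + ne x1 x2 (up x3 x4 x5) = 0) ∧
  (∀ x1 x2 x3 x4 x5 : A,
    ne (star3 nw up ne x1 x2 x3) x4 x5 + ne x1 (star3 nw up ne x2 x3 x4) x5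
      + ne x1 x2 (ne x3 x4 x5) = 0)

/-- Let `(A, (·,·,·))` be a partially associative 3-algebra over a field `k`
and `P` a Rota-Baxter operator of weight zero on it. Then
`↖(x,y,z) := (x,P y,P z)`, `↑(x,y,z) := (P x,y,P z)`, `↗(x,y,z) := (P x,P y,z)`
make `A` into a partially dendriform 3-algebra. -/
theorem rotaBaxter_partAssoc3_partDend3 {k A : Type*} [Field k] [AddCommGroup A] [Module k A]
    (m : A →ₗ[k] A →ₗ[k] A →ₗ[k] A)
    (hm : PartAssoc3 (fun x y z => m x y z))
    (P : A →ₗ[k] A)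
    (hP : ∀ x y z : A,
      m (P x) (P y) (P z) = P (m x (P y) (P z) + m (P x) y (P z) + m (P x) (P y) z)) :
    PartDend3 (fun x y z => m x (P y) (P z)) (fun x y z => m (P x) y (P z))
      (fun x y z => m (P x) (P y) z) := by
  refine ⟨?_, ?_, ?_, ?_, ?_⟩ <;> intro x1 x2 x3 x4 x5 <;> simp only [star3, ← hP]
  · exact hm x1 (P x2) (P x3) (P x4) (P x5)
  · exact hm (P x1) x2 (P x3) (P x4) (P x5)
  · exact hm (P x1) (P x2) x3 (P x4) (P x5)
  · exact hm (P x1) (P x2) (P x3) x4 (P x5)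
  · exact hm (P x1) (P x2) (P x3) (P x4) x5
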